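/- Let I ⊆ R be a P-homogeneous ideal, ≼ a monomial order, and d ∈ ℕ. Suppose G acts monomially on I up to degree d, the action of G is P-compatible, and there are variables e_1,…,e_m of R, with deg(e_i) = ē_i, on which G acts transitively (for each j there is g_j ∈ G with g_j(e_1) = e_j). Let Q ⊆ in_≼(I) be a monomial ideal generated by monomials of total degree at most d such that: (1) e_1 is a nonzerodivisor on R/Q; (2) for every g ∈ G and every D ∈ P, dim_k (R/Q)_D = dim_k (R/g(Q))_D, where g(Q) is the monomial ideal generated by the images under g of the monomials of Q; (3) for every D ∈ P there exist natural numbers a_1,…,a_m with dim_k Q_{D + a_1ē_1 + … + a_mē_m} = dim_k I_{D + a_1ē_1 + … + a_mē_m}. Then Q = in_≼(I). -/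

import Mathlib

open MvPolynomial

/-- The image of a monomial (exponent vector) under a permutation `g` of the variables. -/
noncomputable def actMon {n : ℕ} (g : Equiv.Perm (Fin n)) (a : Fin n →₀ ℕ) : Fin n →₀ ℕ :=
  Finsupp.mapDomain g a

/-- Total degree of an exponent vector. -/
def tdeg {n : ℕ} (a : Fin n →₀ ℕ) : ℕ := a.sum fun _ e => e

/-- `le` is a monomial order. -/
def IsMonOrder {n : ℕ} (le : (Fin n →₀ ℕ) → (Fin n →₀ ℕ) → Prop) : Prop :=
  (∀ a b, le a b ∨ le b a) ∧ (∀ a b, le a b → le b a → a = b) ∧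
    (∀ a b c, le a b → le b c → le a c) ∧ (∀ a, le 0 a) ∧
    (∀ a b c, le a b → le (a + c) (b + c))

/-- The initial ideal of `I` with respect to the monomial order `le`. -/
noncomputable def initIdeal {k : Type*} [Field k] {n : ℕ}
    (le : (Fin n →₀ ℕ) → (Fin n →₀ ℕ) → Prop) (I : Ideal (MvPolynomial (Fin n) k)) :
    Ideal (MvPolynomial (Fin n) k) :=
  Ideal.span { m | ∃ f ∈ I, f ≠ 0 ∧ ∃ a ∈ f.support,
    (∀ b ∈ f.support, le b a) ∧ m = monomial a (1 : k) }

/-- `G` acts monomially on `I` up to degree `d`. -/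
def MonomialActionUpTo {k : Type*} [Field k] {n : ℕ} {G : Type*} [Group G]
    (ρ : G →* Equiv.Perm (Fin n)) (I : Ideal (MvPolynomial (Fin n) k)) (d : ℕ) : Prop :=
  ∀ g : G, ∀ h ∈ I, h.totalDegree ≤ d →
    ∃ h' ∈ I, h'.support = h.support.image (actMon (ρ g))

/-- The `P`-degree of a monomial, for the grading assigning degree `deg i` to `x_i`. -/
def mdeg {n : ℕ} {P : Type*} [AddCommMonoid P] (deg : Fin n → P) (a : Fin n →₀ ℕ) : P :=
  a.sum fun i e => e • deg i

/-- An ideal is `P`-homogeneous if it is generated by `P`-homogeneous elements. -/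
def IsPHomog {k : Type*} [Field k] {n : ℕ} {P : Type*} [AddCommMonoid P]
    (deg : Fin n → P) (I : Ideal (MvPolynomial (Fin n) k)) : Prop :=
  ∃ S : Set (MvPolynomial (Fin n) k), I = Ideal.span S ∧
    ∀ f ∈ S, ∃ D : P, ∀ a ∈ f.support, mdeg deg a = D

/-- The `k`-subspace of `P`-homogeneous polynomials of degree `D`. -/
noncomputable def degSub {k : Type*} [Field k] {n : ℕ} {P : Type*} [AddCommMonoid P]
    (deg : Fin n → P) (D : P) : Submodule k (MvPolynomial (Fin n) k) :=
  Submodule.span k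
    ((fun a => (monomial a (1 : k) : MvPolynomial (Fin n) k)) '' { a | mdeg deg a = D })

/-- The degree-`D` graded piece `Q_D` of a `P`-homogeneous ideal `Q`: the `k`-vector space of
`P`-homogeneous elements of degree `D` lying in `Q`. -/
noncomputable def idealPiece {k : Type*} [Field k] {n : ℕ} {P : Type*} [AddCommMonoid P]
    (Q : Ideal (MvPolynomial (Fin n) k)) (deg : Fin n → P) (D : P) :
    Submodule k (MvPolynomial (Fin n) k) :=
  Submodule.restrictScalars k Q ⊓ degSub deg D

/-- The degree-`D` graded piece `(R/Q)_D` of the quotient: the image in `R/Q` of the span of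
the monomials of degree `D`. -/
noncomputable def quotPiece {k : Type*} [Field k] {n : ℕ} {P : Type*} [AddCommMonoid P]
    (Q : Ideal (MvPolynomial (Fin n) k)) (deg : Fin n → P) (D : P) :
    Submodule k
      (MvPolynomial (Fin n) k ⧸ Submodule.restrictScalars k Q) :=
  Submodule.map (Submodule.restrictScalars k Q).mkQ (degSub deg D)

/-- The set of `le`-leading exponents of the nonzero elements of a set of polynomials. -/
def leadExps {k : Type*} [Field k] {n : ℕ} (le : (Fin n →₀ ℕ) → (Fin n →₀ ℕ) → Prop)
    (V : Set (MvPolynomial (Fin n) k)) : Set (Fin n →₀ ℕ) :=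
  { a | ∃ f ∈ V, a ∈ f.support ∧ ∀ b ∈ f.support, le b a }

section MonomialOrder

variable {n : ℕ} {le : (Fin n →₀ ℕ) → (Fin n →₀ ℕ) → Prop}

theorem IsMonOrder.exists_max (hle : IsMonOrder le) (s : Finset (Fin n →₀ ℕ))
    (hs : s.Nonempty) : ∃ a ∈ s, ∀ b ∈ s, le b a := by
  obtain ⟨htot, -, htr, -⟩ := hle
  induction hs using Finset.Nonempty.cons_induction with
  | singleton a => exact ⟨a, by simp, by simpa using (htot a a)⟩
  | cons a s ha hs ih =>
    obtain ⟨c, hc, hmax⟩ := ih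
    rcases htot a c with h | h
    · refine ⟨c, by simp [hc], fun b hb => ?_⟩
      rcases Finset.mem_cons.1 hb with rfl | hb
      exacts [h, hmax b hb]
    · refine ⟨a, by simp, fun b hb => ?_⟩
      rcases Finset.mem_cons.1 hb with rfl | hb
      exacts [(htot b b).elim id id, htr _ _ _ (hmax b hb) h]

theorem actMon_add (g : Equiv.Perm (Fin n)) (a b : Fin n →₀ ℕ) :
    actMon g (a + b) = actMon g a + actMon g b :=
  Finsupp.mapDomain_add

theorem actMon_injective (g : Equiv.Perm (Fin n)) :
    Function.Injective (actMon g) :=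
  Finsupp.mapDomain_injective g.injective

theorem actMon_inv_actMon (g : Equiv.Perm (Fin n)) (a : Fin n →₀ ℕ) :
    actMon g⁻¹ (actMon g a) = a := by
  rw [actMon, actMon, ← Finsupp.mapDomain_comp, ← Equiv.Perm.coe_mul, inv_mul_cancel,
    Equiv.Perm.coe_one, Finsupp.mapDomain_id]

theorem IsMonOrder.comp_actMon (hle : IsMonOrder le) (g : Equiv.Perm (Fin n)) :
    IsMonOrder fun a b => le (actMon g a) (actMon g b) := by
  obtain ⟨htot, hanti, htr, h0, hadd⟩ := hle
  refine ⟨fun a b => htot _ _, fun a b h h' => actMon_injective g (hanti _ _ h h'),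
    fun a b c => htr _ _ _, fun a => ?_, fun a b c h => ?_⟩
  · simpa [actMon] using h0 (actMon g a)
  · simpa only [actMon_add] using hadd _ _ (actMon g c) h

end MonomialOrder

section Grading

variable {n : ℕ} {P : Type*} [AddCommMonoid P]

theorem mdeg_eq_weight (deg : Fin n → P) (a : Fin n →₀ ℕ) :
    mdeg deg a = Finsupp.weight deg a := by
  rw [Finsupp.weight_apply]; rfl

theorem lam_mdeg (deg : Fin n → P) (lam : P →+ ℕ) (hlam : ∀ i, lam (deg i) = 1)
    (a : Fin n →₀ ℕ) : lam (mdeg deg a) = tdeg a := by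
  simp [mdeg, tdeg, Finsupp.sum, hlam]

theorem finite_setOf_mdeg_eq (deg : Fin n → P) (lam : P →+ ℕ) (hlam : ∀ i, lam (deg i) = 1)
    (D : P) : { a | mdeg deg a = D }.Finite := by
  refine (Set.finite_Icc 0 (Finsupp.equivFunOnFinite.symm fun _ : Fin n => lam D)).subset ?_
  rintro a rfl
  refine ⟨zero_le, fun i => ?_⟩
  rw [lam_mdeg deg lam hlam, tdeg]
  by_cases hi : i ∈ a.support
  · exact Finset.single_le_sum (f := fun i => a i) (fun _ _ => Nat.zero_le _) hi
  · simp [Finsupp.notMem_support_iff.1 hi]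

variable {k : Type*} [Field k]

theorem mem_degSub (deg : Fin n → P) (D : P) (f : MvPolynomial (Fin n) k) :
    f ∈ degSub deg D ↔ ∀ a ∈ f.support, mdeg deg a = D := by
  rw [degSub, ← MvPolynomial.restrictSupport_eq_span]
  exact MvPolynomial.mem_restrictSupport_iff k

theorem finite_degSub (deg : Fin n → P) (lam : P →+ ℕ) (hlam : ∀ i, lam (deg i) = 1) (D : P) :
    Module.Finite k (degSub (k := k) deg D) :=
  Module.Finite.span_of_finite k ((finite_setOf_mdeg_eq deg lam hlam D).image _)

theorem IsPHomog.component_mem {deg : Fin n → P} {I : Ideal (MvPolynomial (Fin n) k)}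
    (hI : IsPHomog deg I) (D : P) {f : MvPolynomial (Fin n) k} (hf : f ∈ I) :
    weightedHomogeneousComponent deg D f ∈ I := by
  classical
  obtain ⟨S, rfl, hS⟩ := hI
  let := weightedGradedAlgebra k deg
  have key : (Ideal.span S).IsHomogeneous (weightedHomogeneousSubmodule k deg) := by
    refine Ideal.homogeneous_span _ _ fun f hf => ?_
    obtain ⟨D, hD⟩ := hS f hf
    refine ⟨D, fun a ha => ?_⟩
    rw [← mdeg_eq_weight]
    exact hD a (mem_support_iff.2 ha)
  rw [← weightedDecomposition.decompose'_apply]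
  exact key D hf

/-- A polynomial space supported on finitely many monomials has as many leading exponents as its
dimension. -/
theorem finrank_eq_ncard_leadExps {le : (Fin n →₀ ℕ) → (Fin n →₀ ℕ) → Prop}
    (hle : IsMonOrder le) (V : Submodule k (MvPolynomial (Fin n) k)) [Module.Finite k V]
    (hfin : (leadExps le (V : Set (MvPolynomial (Fin n) k))).Finite) :
    Module.finrank k V = (leadExps le (V : Set (MvPolynomial (Fin n) k))).ncard := by
  classical
  set L := leadExps le (V : Set (MvPolynomial (Fin n) k)) with hL
  have : Fintype L := hfin.fintype
  have hcard : L.ncard = Fintype.card L := by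
    rw [← Nat.card_coe_set_eq, Nat.card_eq_fintype_card]
  rw [hcard]
  apply le_antisymm
  · let φ : V →ₗ[k] (L → k) :=
      LinearMap.pi fun a => (lcoeff k a.1).comp V.subtype
    have hφ : Function.Injective φ := by
      rw [injective_iff_map_eq_zero]
      intro f hf
      by_contra hne
      have hs : f.1.support.Nonempty := by
        rw [support_nonempty]
        simpa using hne
      obtain ⟨a, ha, hmax⟩ := hle.exists_max _ hs
      exact mem_support_iff.1 ha (congrFun hf ⟨a, f.1, f.2, ha, hmax⟩)
    simpa using LinearMap.finrank_le_finrank_of_injective hφ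
  · choose F hFV hFa hFmax using fun a : L => a.2
    have hli : LinearIndependent k fun a : L => (⟨F a, hFV a⟩ : V) := by
      rw [Fintype.linearIndependent_iff]
      intro c hc
      by_contra! hne
      obtain ⟨i, hi⟩ := hne
      obtain ⟨b, hb, hmax⟩ := hle.exists_max
        ((Finset.univ.filter fun a : L => c a ≠ 0).map (Function.Embedding.subtype _))
        ⟨i, by simpa using hi⟩
      simp only [Finset.mem_map, Finset.mem_filter, Finset.mem_univ, true_and,
        Function.Embedding.subtype_apply] at hb hmax
      obtain ⟨b, hcb, rfl⟩ := hb
      have h0 : coeff b.1 (∑ a, c a • F a) = 0 := by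
        have := congrArg (fun f : V => coeff b.1 f.1) hc
        simpa using this
      rw [coeff_sum, Finset.sum_eq_single b] at h0
      · rw [coeff_smul, smul_eq_mul] at h0
        exact mul_ne_zero hcb (mem_support_iff.1 (hFa b)) h0
      · intro a _ hab
        rw [coeff_smul, smul_eq_mul]
        by_contra hne
        refine hab (Subtype.ext (hle.2.1 _ _ (hmax a ⟨a, left_ne_zero_of_mul hne, rfl⟩)
          (hFmax a b (mem_support_iff.2 (right_ne_zero_of_mul hne)))))
      · simp
    exact hli.fintype_card_le_finrank

variable {deg : Fin n → P} {le : (Fin n →₀ ℕ) → (Fin n →₀ ℕ) → Prop}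

theorem leadExps_idealPiece {I : Ideal (MvPolynomial (Fin n) k)} (hI : IsPHomog deg I) (D : P) :
    leadExps le (idealPiece I deg D : Set (MvPolynomial (Fin n) k)) =
      leadExps le (I : Set (MvPolynomial (Fin n) k)) ∩ { a | mdeg deg a = D } := by
  classical
  ext a
  constructor
  · rintro ⟨f, hf, ha, hmax⟩
    exact ⟨⟨f, hf.1, ha, hmax⟩, (mem_degSub deg D f).1 hf.2 a ha⟩
  · rintro ⟨⟨f, hf, ha, hmax⟩, hD⟩
    have hcoeff : ∀ b, b ∈ (weightedHomogeneousComponent deg D f).support ↔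
        b ∈ f.support ∧ mdeg deg b = D := by
      intro b
      rw [mem_support_iff, coeff_weightedHomogeneousComponent, mdeg_eq_weight, mem_support_iff]
      split_ifs with h <;> simp [h]
    refine ⟨weightedHomogeneousComponent deg D f,
      ⟨hI.component_mem D hf, (mem_degSub deg D _).2 fun b hb => ((hcoeff b).1 hb).2⟩,
      (hcoeff a).2 ⟨ha, hD⟩, fun b hb => hmax b ((hcoeff b).1 hb).1⟩

theorem finrank_idealPiece (lam : P →+ ℕ) (hlam : ∀ i, lam (deg i) = 1) (hle : IsMonOrder le)
    {I : Ideal (MvPolynomial (Fin n) k)} (hI : IsPHomog deg I) (D : P) :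
    Module.finrank k (idealPiece I deg D) =
      (leadExps le (I : Set (MvPolynomial (Fin n) k)) ∩ { a | mdeg deg a = D }).ncard := by
  have := finite_degSub (k := k) deg lam hlam D
  have : Module.Finite k (idealPiece I deg D) :=
    Submodule.finiteDimensional_of_le (inf_le_right : idealPiece I deg D ≤ degSub deg D)
  rw [← leadExps_idealPiece hI]
  refine finrank_eq_ncard_leadExps hle _ ?_
  rw [leadExps_idealPiece hI]
  exact (finite_setOf_mdeg_eq deg lam hlam D).inter_of_right _

theorem finrank_quotPiece_add_finrank_idealPiece (lam : P →+ ℕ) (hlam : ∀ i, lam (deg i) = 1)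
    (Q : Ideal (MvPolynomial (Fin n) k)) (D : P) :
    Module.finrank k (quotPiece Q deg D) + Module.finrank k (idealPiece Q deg D) =
      Module.finrank k (degSub (k := k) deg D) := by
  have := finite_degSub (k := k) deg lam hlam D
  have h := LinearMap.finrank_range_add_finrank_ker
    ((Submodule.restrictScalars k Q).mkQ.domRestrict (degSub (k := k) deg D))
  rw [LinearMap.range_domRestrict, LinearMap.ker_domRestrict, Submodule.ker_mkQ] at h
  rw [← h]
  congr 1
  refine (Submodule.comapSubtypeEquivOfLe
    (inf_le_right : idealPiece Q deg D ≤ degSub deg D)).finrank_eq.symm.trans ?_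
  rw [Submodule.comap_inf, Submodule.comap_subtype_self, inf_top_eq]

end Grading

section Ideals

variable {n : ℕ} {k : Type*} [Field k] {le : (Fin n →₀ ℕ) → (Fin n →₀ ℕ) → Prop}

theorem monomial_mem_span_iff (S : Set (Fin n →₀ ℕ)) (a : Fin n →₀ ℕ) :
    monomial a (1 : k) ∈ Ideal.span ((fun a => (monomial a (1 : k))) '' S) ↔
      ∃ s ∈ S, s ≤ a := by
  rw [mem_ideal_span_monomial_image]
  classical
  simp [support_monomial]

theorem isPHomog_span_monomial {P : Type*} [AddCommMonoid P] (deg : Fin n → P)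
    (S : Set (Fin n →₀ ℕ)) :
    IsPHomog deg (Ideal.span ((fun a => (monomial a (1 : k))) '' S)) := by
  classical
  refine ⟨_, rfl, ?_⟩
  rintro _ ⟨a, -, rfl⟩
  exact ⟨mdeg deg a, by simp [support_monomial]⟩

theorem leadExps_span_monomial (hle : IsMonOrder le) (S : Set (Fin n →₀ ℕ)) :
    leadExps le (Ideal.span ((fun a => (monomial a (1 : k))) '' S) :
      Set (MvPolynomial (Fin n) k)) = { a | ∃ s ∈ S, s ≤ a } := by
  classical
  ext a
  constructor
  · rintro ⟨f, hf, ha, -⟩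
    exact mem_ideal_span_monomial_image.1 hf a ha
  · intro ha
    exact ⟨monomial a 1, (monomial_mem_span_iff S a).2 ha, by simp [support_monomial],
      by simpa [support_monomial] using hle.1 a a⟩

theorem leadExps_upward_closed (hle : IsMonOrder le) (I : Ideal (MvPolynomial (Fin n) k))
    {a b : Fin n →₀ ℕ} (hab : a ≤ b) (ha : a ∈ leadExps le (I : Set (MvPolynomial (Fin n) k))) :
    b ∈ leadExps le (I : Set (MvPolynomial (Fin n) k)) := by
  obtain ⟨c, rfl⟩ := exists_add_of_le hab
  obtain ⟨f, hf, ha, hmax⟩ := ha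
  refine ⟨f * monomial c 1, I.mul_mem_right _ hf, ?_, fun b hb => ?_⟩
  · simpa using ha
  · rw [mem_support_iff, coeff_mul_monomial'] at hb
    split_ifs at hb with hcb
    · have := hle.2.2.2.2 _ _ c (hmax (b - c) (mem_support_iff.2 (by simpa using hb)))
      rwa [tsub_add_cancel_of_le hcb] at this
    · exact absurd rfl hb

theorem initIdeal_eq_span_leadExps (I : Ideal (MvPolynomial (Fin n) k)) :
    initIdeal le I = Ideal.span ((fun a => (monomial a (1 : k))) ''
      leadExps le (I : Set (MvPolynomial (Fin n) k))) := by
  rw [initIdeal]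
  congr 1
  ext p
  constructor
  · rintro ⟨f, hf, -, a, ha, hmax, rfl⟩
    exact ⟨a, ⟨f, hf, ha, hmax⟩, rfl⟩
  · rintro ⟨a, ⟨f, hf, ha, hmax⟩, rfl⟩
    exact ⟨f, hf, support_nonempty.1 ⟨a, ha⟩, a, ha, hmax, rfl⟩

theorem map_rename_span_monomial (g : Equiv.Perm (Fin n)) (S : Set (Fin n →₀ ℕ)) :
    Ideal.map (rename (⇑g) : MvPolynomial (Fin n) k →ₐ[k] MvPolynomial (Fin n) k)
      (Ideal.span ((fun a => (monomial a (1 : k))) '' S)) =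
      Ideal.span ((fun a => (monomial a (1 : k))) '' (actMon g '' S)) := by
  rw [Ideal.map_span, Set.image_image, Set.image_image]
  simp only [rename_monomial, actMon]

/-- Leading exponents of degree at most `d` are carried by `g` to leading exponents for the
transported order. -/
theorem actMon_mem_leadExps {G : Type*} [Group G] {P : Type*} [AddCommMonoid P]
    {deg : Fin n → P} (lam : P →+ ℕ) (hlam : ∀ i, lam (deg i) = 1) {ρ : G →* Equiv.Perm (Fin n)}
    {I : Ideal (MvPolynomial (Fin n) k)} (hI : IsPHomog deg I) {d : ℕ}
    (hmon : MonomialActionUpTo ρ I d) (g : G) {a : Fin n →₀ ℕ} (had : tdeg a ≤ d)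
    (ha : a ∈ leadExps le (I : Set (MvPolynomial (Fin n) k))) :
    actMon (ρ g) a ∈ leadExps (fun b c => le (actMon (ρ g)⁻¹ b) (actMon (ρ g)⁻¹ c))
      (I : Set (MvPolynomial (Fin n) k)) := by
  have ha' : a ∈ leadExps le
      (idealPiece I deg (mdeg deg a) : Set (MvPolynomial (Fin n) k)) := by
    rw [leadExps_idealPiece hI]
    exact ⟨ha, rfl⟩
  obtain ⟨f, hf, ha, hmax⟩ := ha'
  obtain ⟨f', hf', hsupp⟩ := hmon g f hf.1 <| by
    refine Finset.sup_le fun b hb => ?_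
    have := (mem_degSub deg _ f).1 hf.2 b hb
    have := congrArg lam this
    rw [lam_mdeg deg lam hlam, lam_mdeg deg lam hlam] at this
    exact this.le.trans had
  refine ⟨f', hf', ?_, fun b hb => ?_⟩
  · rw [hsupp]; exact Finset.mem_image_of_mem _ ha
  · rw [hsupp, Finset.mem_image] at hb
    obtain ⟨c, hc, rfl⟩ := hb
    simpa only [actMon_inv_actMon] using hmax c hc

end Ideals

/-- Let `I` be `P`-homogeneous, `G` act monomially on `I` up to degree `d` and
`P`-compatibly, and transitively on the variables `e_1,…,e_m` (indices `v 0,…,v m`). If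
`Q ⊆ in_≼(I)` is a monomial ideal generated in total degree at most `d` such that (1) `e_1` is a
nonzerodivisor on `R/Q`, (2) the multigraded Hilbert function of `R/Q` is invariant under
replacing `Q` by `g(Q)`, and (3) in sufficiently shifted degrees `Q` and `I` have the same
dimensions, then `Q = in_≼(I)`. -/
theorem stmt6 {k : Type*} [Field k] {n : ℕ} {G : Type*} [Group G]
    {P : Type*} [AddCommMonoid P] (deg : Fin n → P)
    (lam : P →+ ℕ) (hlam : ∀ i, lam (deg i) = 1)
    (ρ : G →* Equiv.Perm (Fin n)) (I : Ideal (MvPolynomial (Fin n) k))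
    (hI : IsPHomog deg I)
    (le : (Fin n →₀ ℕ) → (Fin n →₀ ℕ) → Prop) (hle : IsMonOrder le)
    (d : ℕ) (hmon : MonomialActionUpTo ρ I d)
    (hcomp : ∀ g : G, ∃ ghat : P ≃+ P,
      ∀ a : Fin n →₀ ℕ, mdeg deg (actMon (ρ g) a) = ghat (mdeg deg a))
    (m : ℕ) (v : Fin (m + 1) → Fin n) (hv : Function.Injective v)
    (htrans : ∀ j : Fin (m + 1), ∃ g : G, ρ g (v 0) = v j)
    (Q : Ideal (MvPolynomial (Fin n) k))
    (hQmono : ∃ S : Set (Fin n →₀ ℕ), (∀ a ∈ S, tdeg a ≤ d) ∧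
      Q = Ideal.span ((fun a => (monomial a (1 : k) : MvPolynomial (Fin n) k)) '' S))
    (hQI : Q ≤ initIdeal le I)
    (h1 : ∀ f : MvPolynomial (Fin n) k, X (v 0) * f ∈ Q → f ∈ Q)
    (h2 : ∀ (g : G) (D : P),
      Module.finrank k (quotPiece Q deg D) =
        Module.finrank k
          (quotPiece
            (Ideal.map (rename (⇑(ρ g)) : MvPolynomial (Fin n) k →ₐ[k] MvPolynomial (Fin n) k) Q)
            deg D))
    (h3 : ∀ D : P, ∃ a : Fin (m + 1) → ℕ,
      Module.finrank k (idealPiece Q deg (D + ∑ i, a i • deg (v i)))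
        = Module.finrank k (idealPiece I deg (D + ∑ i, a i • deg (v i)))) :
    Q = initIdeal le I := by
  obtain ⟨S, hS, rfl⟩ := hQmono
  rw [initIdeal_eq_span_leadExps] at hQI ⊢
  set L := leadExps le (I : Set (MvPolynomial (Fin n) k)) with hL
  have hSL : ∀ s ∈ S, s ∈ L := by
    intro s hs
    obtain ⟨t, ht, hts⟩ := (monomial_mem_span_iff L s).1
      (hQI (Ideal.subset_span ⟨s, hs, rfl⟩))
    exact leadExps_upward_closed hle I hts ht
  set Q := Ideal.span ((fun a => (monomial a (1 : k) : MvPolynomial (Fin n) k)) '' S) with hQ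
  have hgQ : ∀ (g : G) (D : P), Module.finrank k (idealPiece Q deg D) =
      ({ a | ∃ s ∈ actMon (ρ g) '' S, s ≤ a } ∩ { a | mdeg deg a = D }).ncard := by
    intro g D
    have h := h2 g D
    rw [hQ, map_rename_span_monomial] at h
    have e₁ := finrank_quotPiece_add_finrank_idealPiece lam hlam Q D
    have e₂ := finrank_quotPiece_add_finrank_idealPiece (k := k) lam hlam
      (Ideal.span ((fun a => (monomial a (1 : k))) '' (actMon (ρ g) '' S))) D
    rw [finrank_idealPiece lam hlam hle (isPHomog_span_monomial deg _),
      leadExps_span_monomial hle] at e₂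
    rw [hQ] at e₁
    rw [hQ]
    omega
  have hsub : ∀ g : G, { a | ∃ s ∈ actMon (ρ g) '' S, s ≤ a } ⊆
      leadExps (fun b c => le (actMon (ρ g)⁻¹ b) (actMon (ρ g)⁻¹ c))
        (I : Set (MvPolynomial (Fin n) k)) := by
    rintro g a ⟨_, ⟨s, hs, rfl⟩, hsa⟩
    exact leadExps_upward_closed (hle.comp_actMon _) I hsa
      (actMon_mem_leadExps lam hlam hI hmon g (hS s hs) (hSL s hs))
  have hfull : ∀ (g : G) (D : P),
      Module.finrank k (idealPiece Q deg D) = Module.finrank k (idealPiece I deg D) →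
      { a | ∃ s ∈ actMon (ρ g) '' S, s ≤ a } ∩ { a | mdeg deg a = D } =
      leadExps (fun b c => le (actMon (ρ g)⁻¹ b) (actMon (ρ g)⁻¹ c))
        (I : Set (MvPolynomial (Fin n) k)) ∩ { a | mdeg deg a = D } := by
    intro g D h
    rw [hgQ g, finrank_idealPiece lam hlam (hle.comp_actMon (ρ g)⁻¹) hI] at h
    exact Set.eq_of_subset_of_ncard_le (Set.inter_subset_inter_left _ (hsub g)) h.ge
      ((finite_setOf_mdeg_eq deg lam hlam D).inter_of_right _)
  have hstep : ∀ (j : Fin (m + 1)) (D : P),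
      Module.finrank k (idealPiece Q deg (D + deg (v j))) =
        Module.finrank k (idealPiece I deg (D + deg (v j))) →
      Module.finrank k (idealPiece Q deg D) = Module.finrank k (idealPiece I deg D) := by
    intro j D h
    obtain ⟨g, hg⟩ := htrans j
    rw [hgQ g, finrank_idealPiece lam hlam (hle.comp_actMon (ρ g)⁻¹) hI]
    congr 1
    refine (Set.inter_subset_inter_left _ (hsub g)).antisymm ?_
    rintro u ⟨hu, rfl⟩
    refine ⟨?_, rfl⟩
    have hmem : u + Finsupp.single (v j) 1 ∈
        { a | ∃ s ∈ actMon (ρ g) '' S, s ≤ a } ∩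
          { a | mdeg deg a = mdeg deg u + deg (v j) } := by
      rw [hfull g _ h]
      refine ⟨leadExps_upward_closed (hle.comp_actMon _) I le_self_add hu, ?_⟩
      simp [mdeg_eq_weight, Finsupp.weight_single]
    obtain ⟨⟨_, ⟨s, hs, rfl⟩, c, hc⟩, -⟩ : _ ∧ _ := by
      simpa only [Set.mem_inter_iff, Set.mem_ofPred_eq, le_iff_exists_add] using hmem
    have hc' := congrArg (actMon (ρ g)⁻¹) hc
    have hsingle : actMon (ρ g)⁻¹ (Finsupp.single (v j) 1) = Finsupp.single (v 0) 1 := by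
      rw [actMon, Finsupp.mapDomain_single, ← hg, ← Equiv.Perm.mul_apply, inv_mul_cancel,
        Equiv.Perm.one_apply]
    rw [actMon_add, actMon_add, actMon_inv_actMon, hsingle] at hc'
    have hmemQ : monomial (actMon (ρ g)⁻¹ u) (1 : k) ∈ Q := by
      apply h1
      rw [X, monomial_mul, one_mul, add_comm, hc']
      exact (monomial_mem_span_iff S _).2 ⟨s, hs, le_self_add⟩
    obtain ⟨t, ht, hle_t⟩ := (monomial_mem_span_iff S _).1 hmemQ
    obtain ⟨c, hc⟩ := exists_add_of_le hle_t
    refine ⟨actMon (ρ g) t, ⟨t, ht, rfl⟩, ?_⟩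
    have := congrArg (actMon (ρ g)) hc
    have hinv := actMon_inv_actMon (ρ g)⁻¹ u
    rw [inv_inv] at hinv
    rw [hinv, actMon_add] at this
    rw [this]
    exact le_self_add
  have hnsmul : ∀ (j : Fin (m + 1)) (N : ℕ) (D : P),
      Module.finrank k (idealPiece Q deg (D + N • deg (v j))) =
        Module.finrank k (idealPiece I deg (D + N • deg (v j))) →
      Module.finrank k (idealPiece Q deg D) = Module.finrank k (idealPiece I deg D) := by
    intro j N
    induction N with
    | zero => intro D h; rwa [zero_nsmul, add_zero] at h
    | succ N ih =>
      intro D h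
      rw [succ_nsmul, ← add_assoc] at h
      exact ih D (hstep j _ h)
  have hsum : ∀ (a : Fin (m + 1) → ℕ) (s : Finset (Fin (m + 1))) (D : P),
      Module.finrank k (idealPiece Q deg (D + ∑ i ∈ s, a i • deg (v i))) =
        Module.finrank k (idealPiece I deg (D + ∑ i ∈ s, a i • deg (v i))) →
      Module.finrank k (idealPiece Q deg D) = Module.finrank k (idealPiece I deg D) := by
    intro a s
    induction s using Finset.cons_induction with
    | empty => intro D h; rwa [Finset.sum_empty, add_zero] at h
    | cons j s hj ih =>
      intro D h
      rw [Finset.sum_cons, ← add_assoc] at h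
      exact hnsmul j (a j) D (ih _ h)
  refine le_antisymm hQI (Ideal.span_le.2 ?_)
  rintro _ ⟨u, hu, rfl⟩
  obtain ⟨a, ha⟩ := h3 (mdeg deg u)
  have heq := hfull 1 _ (hsum a _ _ ha)
  have hone : ∀ b : Fin n →₀ ℕ, actMon (1 : Equiv.Perm (Fin n)) b = b := fun b =>
    Finsupp.mapDomain_id
  simp only [map_one, inv_one, hone, Set.image_id'] at heq
  have hmem : u ∈ L ∩ { b | mdeg deg b = mdeg deg u } := ⟨hu, rfl⟩
  rw [hL, ← heq] at hmem
  exact (monomial_mem_span_iff S u).2 hmem.1
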